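/- For φ, t₁, t₂ ∈ ℝ, let 𝔩ᵢ = 2 sin φ · e₂ − tᵢ e₃ − 2 cos φ · e₅ − tᵢ e₆ ∈ ℝ⁶ (i = 1, 2) be two parallel lines at distances proportional to tᵢ from the origin. Then in Cl(4,2), with g = ι(e₂)ι(e₃) + ι(e₂)ι(e₆) and f = ι(e₃)ι(e₅) − ι(e₅)ι(e₆): ι(𝔩₁) · ι(𝔩₂) = 4·1 + 2(t₁ − t₂) sin φ · g + 2(t₁ − t₂) cos φ · f; i.e. the composition of reflections in two parallel lines is a scalar multiple of a translation element 2 + s sin φ · g + s cos φ · f. -/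

import Mathlib

/-- The bilinear form on `ℝ⁶` whose matrix has entries `B₂₂ = B₅₅ = 1`,
`B₁₃ = B₃₁ = B₄₆ = B₆₄ = −1` (indices 0-based here). -/
noncomputable def B6 : LinearMap.BilinMap ℝ (Fin 6 → ℝ) ℝ :=
  LinearMap.mk₂ ℝ
    (fun u w => u 1 * w 1 + u 4 * w 4 - u 0 * w 2 - u 2 * w 0 - u 3 * w 5 - u 5 * w 3)
    (by intros; simp only [Pi.add_apply]; ring)
    (by intros; simp only [Pi.smul_apply, smul_eq_mul]; ring)
    (by intros; simp only [Pi.add_apply]; ring)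
    (by intros; simp only [Pi.smul_apply, smul_eq_mul]; ring)

/-- The quadratic form `Q(v) = v₂² + v₅² − 2v₁v₃ − 2v₄v₆` on `ℝ⁶`, of signature `(4,2)`. -/
noncomputable def Q6 : QuadraticForm ℝ (Fin 6 → ℝ) := B6.toQuadraticMap

/-- The standard basis of `ℝ⁶`; `e i` corresponds to `e_{i+1}` in the paper. -/
noncomputable def e (i : Fin 6) : Fin 6 → ℝ := Pi.single i 1

open CliffordAlgebra

/-- `g = e₂e₃ + e₂e₆`, corresponding to `e_{23} + e_{26}` in the paper. -/
noncomputable def g : CliffordAlgebra Q6 := ι Q6 (e 1) * ι Q6 (e 2) + ι Q6 (e 1) * ι Q6 (e 5)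

/-- `f = e₃e₅ − e₅e₆`, corresponding to `e_{35} − e_{56}` in the paper. -/
noncomputable def f : CliffordAlgebra Q6 := ι Q6 (e 2) * ι Q6 (e 4) - ι Q6 (e 4) * ι Q6 (e 5)

/-- The line `𝔩 = 2 sin φ · e₂ − t e₃ − 2 cos φ · e₅ − t e₆`, a line with normal
direction `(−sin φ, cos φ)ᵗ` at distance proportional to `t` from the origin. -/
noncomputable def parLine (φ t : ℝ) : Fin 6 → ℝ :=
  (2 * Real.sin φ) • e 1 + (-t) • e 2 + (-2 * Real.cos φ) • e 4 + (-t) • e 5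

theorem Q6_apply (v : Fin 6 → ℝ) :
    Q6 v = v 1 * v 1 + v 4 * v 4 - v 0 * v 2 - v 2 * v 0 - v 3 * v 5 - v 5 * v 3 :=
  rfl

theorem ι_e_mul_swap {i j : Fin 6} (h : Q6 (e i + e j) = Q6 (e i) + Q6 (e j)) :
    ι Q6 (e j) * ι Q6 (e i) = -(ι Q6 (e i) * ι Q6 (e j)) :=
  (neg_eq_of_add_eq_zero_right (ι_mul_ι_add_swap_of_isOrtho h)).symm

theorem ι_e_mul_self {i : Fin 6} {r : ℝ} (h : Q6 (e i) = r) :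
    ι Q6 (e i) * ι Q6 (e i) = r • (1 : CliffordAlgebra Q6) := by
  rw [ι_sq_scalar, h, Algebra.algebraMap_eq_smul_one]

/-- the composition of reflections in two parallel lines is a scalar
multiple of a translation element `2 + s sin φ · g + s cos φ · f`. -/
theorem reflections_in_parallel_lines_compose_to_translation (φ t₁ t₂ : ℝ) :
    ι Q6 (parLine φ t₁) * ι Q6 (parLine φ t₂) =
      (4 : ℝ) • (1 : CliffordAlgebra Q6) +
        (2 * (t₁ - t₂) * Real.sin φ) • g + (2 * (t₁ - t₂) * Real.cos φ) • f := by
  have h11 := ι_e_mul_self (i := 1) (r := 1) (by simp [Q6_apply, e])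
  have h44 := ι_e_mul_self (i := 4) (r := 1) (by simp [Q6_apply, e])
  have h22 := ι_e_mul_self (i := 2) (r := 0) (by simp [Q6_apply, e])
  have h55 := ι_e_mul_self (i := 5) (r := 0) (by simp [Q6_apply, e])
  have h12 := ι_e_mul_swap (i := 1) (j := 2) (by simp [Q6_apply, e])
  have h14 := ι_e_mul_swap (i := 1) (j := 4) (by simp [Q6_apply, e])
  have h15 := ι_e_mul_swap (i := 1) (j := 5) (by simp [Q6_apply, e])
  have h24 := ι_e_mul_swap (i := 2) (j := 4) (by simp [Q6_apply, e])
  have h25 := ι_e_mul_swap (i := 2) (j := 5) (by simp [Q6_apply, e])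
  have h45 := ι_e_mul_swap (i := 4) (j := 5) (by simp [Q6_apply, e])
  simp only [parLine, g, f, map_add, map_smul, add_mul, mul_add, smul_mul_smul_comm,
    h11, h44, h22, h55, h12, h14, h15, h24, h25, h45]
  match_scalars
  · linear_combination 4 * Real.sin_sq_add_cos_sq φ
  all_goals ring
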